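/- For every fixed real μ̃ ≥ 1/2 there exist a constant C > 0 and a threshold μ₀ ≥ 1/2 such that for all μ ≥ μ₀ one has 1 − F(μ, μ̃) ≤ C/μ, where F(μ, μ̃) := (1 − 4μ̃·[√(4μ² − 1) + μ̃ − 2μ(1 + 2μ̃·ξ(μ))])^(−1/4) and ξ(μ) := 2μ − √(4μ² − 1). (This is the asymptotic expansion F(μ, μ̃) ≃ 1 − O(μ⁻¹) for large μ.) -/

import Mathlib

/-- Added noise of the μ-energy Braunstein–Kimble teleportation protocol. -/
noncomputable def xiBK (μ : ℝ) : ℝ := 2*μ - Real.sqrt (4*μ^2 - 1)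

/-- Fidelity between a TMSV state of energy μ̃ and its output under the
μ-energy BK teleportation channel. -/
noncomputable def FBK (μ μt : ℝ) : ℝ :=
  (1 - 4*μt*(Real.sqrt (4*μ^2 - 1) + μt - 2*μ*(1 + 2*μt*xiBK μ))) ^ (-(1/4 : ℝ))

theorem xiBK_sq {μ : ℝ} (hμ : 1/2 ≤ μ) : xiBK μ ^ 2 = 4 * μ * xiBK μ - 1 := by
  have h := Real.sq_sqrt (show (0 : ℝ) ≤ 4*μ^2 - 1 by nlinarith)
  unfold xiBK
  linear_combination h

theorem xiBK_nonneg {μ : ℝ} (hμ : 1/2 ≤ μ) : 0 ≤ xiBK μ :=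
  sub_nonneg.2 (Real.sqrt_le_iff.2 ⟨by linarith, by nlinarith⟩)

theorem two_mul_xiBK_le {μ : ℝ} (hμ : 1/2 ≤ μ) : 2 * xiBK μ ≤ 1 / μ := by
  have h : xiBK μ ≤ 2 * μ := sub_le_self _ (Real.sqrt_nonneg _)
  rw [le_div_iff₀ (by linarith)]
  nlinarith [xiBK_sq hμ, mul_nonneg (xiBK_nonneg hμ) (sub_nonneg.2 h)]

/-- Closed form of the fidelity, obtained by completing the square in its base. -/
theorem FBK_eq {μ μt : ℝ} (hμ : 1/2 ≤ μ) (hμt : 0 ≤ μt) :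
    FBK μ μt = (1 + 2 * μt * xiBK μ) ^ (-(1/2 : ℝ)) := by
  have hx : 0 ≤ 1 + 2 * μt * xiBK μ := by
    have := xiBK_nonneg hμ
    positivity
  have hbase : 1 - 4*μt*(Real.sqrt (4*μ^2 - 1) + μt - 2*μ*(1 + 2*μt*xiBK μ))
      = (1 + 2 * μt * xiBK μ) ^ (2 : ℝ) := by
    have hs : Real.sqrt (4*μ^2 - 1) = 2 * μ - xiBK μ := by unfold xiBK; ring
    rw [hs, Real.rpow_two]
    linear_combination (-4 * μt ^ 2) * xiBK_sq hμ
  rw [FBK, hbase, ← Real.rpow_mul hx]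
  norm_num

theorem bk_fidelity_one_minus_big_O_inv (μt : ℝ) (hμt : 1/2 ≤ μt) :
    ∃ C : ℝ, 0 < C ∧ ∃ μ₀ : ℝ, 1/2 ≤ μ₀ ∧
      ∀ μ : ℝ, μ₀ ≤ μ → 1 - FBK μ μt ≤ C / μ := by
  refine ⟨μt, by linarith, 1/2, le_rfl, fun μ hμ => ?_⟩
  have hξ := xiBK_nonneg hμ
  have hx : 0 ≤ 2 * μt * xiBK μ := by positivity
  have hF : (1 + 2 * μt * xiBK μ)⁻¹ ≤ FBK μ μt := by
    rw [FBK_eq hμ (by linarith), ← Real.rpow_neg_one]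
    exact Real.rpow_le_rpow_of_exponent_le (by linarith) (by norm_num)
  have hinv : 1 - 2 * μt * xiBK μ ≤ (1 + 2 * μt * xiBK μ)⁻¹ := by
    rw [← one_div, le_div_iff₀ (by linarith)]
    nlinarith
  calc 1 - FBK μ μt ≤ μt * (2 * xiBK μ) := by linarith
    _ ≤ μt * (1 / μ) := mul_le_mul_of_nonneg_left (two_mul_xiBK_le hμ) (by linarith)
    _ = μt / μ := by ring
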